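/- For every real x > 0: if m > 0 then V_m(x) < 1/√(x² + m), and if m > -1 then V_m(x) > 1/√(x² + m + 1). -/

import Mathlib

open MeasureTheory Real Set

/-- The one-dimensional regularized Coulomb potential `V_m(x)`. -/
noncomputable def V (m x : ℝ) : ℝ :=
  (1 / Real.Gamma (m + 1)) *
    ∫ u in Set.Ioi (0:ℝ), u ^ m * Real.exp (-u) / Real.sqrt (x ^ 2 + u)

/-- Strict Jensen inequality for the Gamma distribution, with the concavity hypothesis replaced by
an affine upper bound touching at the mean `p`. -/
theorem integral_gamma_weight_lt_of_lt_affine {p A B : ℝ} (hp : 0 < p) {k : ℝ → ℝ}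
    (hk : IntegrableOn (fun u => u ^ (p - 1) * exp (-u) * k u) (Ioi 0))
    (hlt : ∀ u, 0 < u → u ≠ p → k u < A + B * (u - p)) :
    ∫ u in Ioi (0 : ℝ), u ^ (p - 1) * exp (-u) * k u < A * Gamma p := by
  have h0 := Real.GammaIntegral_convergent hp
  have h1 := Real.GammaIntegral_convergent (s := p + 1) (by linarith)
  have e0 := Real.Gamma_eq_integral hp
  have e1 := Real.Gamma_eq_integral (s := p + 1) (by linarith)
  rw [Real.Gamma_add_one hp.ne'] at e1
  have hL : IntegrableOn (fun u => (A - B * p) * (exp (-u) * u ^ (p - 1)) +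
      B * (exp (-u) * u ^ (p + 1 - 1))) (Ioi 0) := (h0.const_mul _).add (h1.const_mul _)
  have eL : ∫ u in Ioi (0 : ℝ), ((A - B * p) * (exp (-u) * u ^ (p - 1)) +
      B * (exp (-u) * u ^ (p + 1 - 1))) = A * Gamma p := by
    rw [integral_add (h0.const_mul _) (h1.const_mul _), integral_const_mul, integral_const_mul,
      ← e0, ← e1]
    ring
  rw [← eL, ← sub_pos, ← integral_sub hL hk]
  have key : ∀ u ∈ Ioi (0 : ℝ), u ≠ p → 0 < (A - B * p) * (exp (-u) * u ^ (p - 1)) +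
      B * (exp (-u) * u ^ (p + 1 - 1)) - u ^ (p - 1) * exp (-u) * k u := by
    intro u hu hup
    have hu' : 0 < u := hu
    have hpow : u ^ (p + 1 - 1) = u ^ (p - 1) * u := by
      rw [← rpow_add_one hu'.ne']; ring_nf
    have hw : 0 < u ^ (p - 1) * exp (-u) := by positivity
    have := mul_pos hw (sub_pos.2 (hlt u hu' hup))
    rw [hpow]
    linarith
  have hne : ∀ᵐ u : ℝ ∂volume.restrict (Ioi 0), u ≠ p := by
    rw [ae_iff]
    simp
  refine (integral_pos_iff_support_of_nonneg_ae ?_ (hL.sub hk)).2 ?_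
  · filter_upwards [ae_restrict_mem measurableSet_Ioi, hne] with u hu hup
    exact (key u hu hup).le
  · rw [Measure.restrict_apply' measurableSet_Ioi]
    refine lt_of_lt_of_le ?_ (measure_mono (s := Ioi p) ?_)
    · simp
    · intro u hu
      have hu0 : 0 < u := hp.trans hu
      exact ⟨(key u hu0 (ne_of_gt hu)).ne', hu0⟩

/-- The convex function `s ↦ 1 / √s` lies strictly above its tangents, written with
`a = √s` and `b = √t`. -/
theorem one_div_gt_tangent {a b : ℝ} (ha : 0 < a) (hb : 0 < b) (hab : a ≠ b) :
    1 / b - 1 / (2 * b ^ 3) * (a ^ 2 - b ^ 2) < 1 / a := by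
  rw [← sub_pos]
  have h : 1 / a - (1 / b - 1 / (2 * b ^ 3) * (a ^ 2 - b ^ 2)) =
      (a - b) ^ 2 * (a + 2 * b) / (2 * a * b ^ 3) := by
    field_simp
    ring
  have : 0 < (a - b) ^ 2 := by
    have := sub_ne_zero.2 hab
    positivity
  rw [h]
  positivity

/-- The concave function `s ↦ (s - y) / √s`, `0 ≤ y`, lies strictly below its tangents, written
with `a = √s` and `b = √t`. -/
theorem sub_div_lt_tangent {a b y : ℝ} (ha : 0 < a) (hb : 0 < b) (hab : a ≠ b) (hy : 0 ≤ y) :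
    (a ^ 2 - y) / a <
      (b ^ 2 - y) / b + (1 / (2 * b) + y / (2 * b ^ 3)) * (a ^ 2 - b ^ 2) := by
  have h1 := mul_le_mul_of_nonneg_left (one_div_gt_tangent ha hb hab).le hy
  have h2 : 0 < (a - b) ^ 2 / (2 * b) := by
    have := sub_ne_zero.2 hab
    positivity
  have h3 : (b ^ 2 - y) / b + (1 / (2 * b) + y / (2 * b ^ 3)) * (a ^ 2 - b ^ 2) - (a ^ 2 - y) / a =
      (a - b) ^ 2 / (2 * b) + (y * (1 / a) - y * (1 / b - 1 / (2 * b ^ 3) * (a ^ 2 - b ^ 2))) := by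
    field_simp
    ring
  linarith

theorem integrableOn_V_integrand {m x : ℝ} (hm : -1 < m) (hx : 0 < x) :
    IntegrableOn (fun u => u ^ m * exp (-u) / √(x ^ 2 + u)) (Ioi 0) := by
  have h0 := Real.GammaIntegral_convergent (s := m + 1) (by linarith)
  refine Integrable.mono' (h0.const_mul (1 / x)) (Measurable.aestronglyMeasurable (by fun_prop)) ?_
  filter_upwards [ae_restrict_mem measurableSet_Ioi] with u hu
  have hu' : 0 < u := hu
  have hs : x ≤ √(x ^ 2 + u) := Real.le_sqrt_of_sq_le (by linarith)
  rw [norm_of_nonneg (by positivity), add_sub_cancel_right, mul_comm (exp _), one_div_mul_eq_div]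
  gcongr

theorem V_bounds (m x : ℝ) (hx : 0 < x) :
    (0 < m → V m x < 1 / Real.sqrt (x ^ 2 + m)) ∧
    (-1 < m → 1 / Real.sqrt (x ^ 2 + m + 1) < V m x) := by
  have sqrt_ne : ∀ {u p : ℝ}, 0 < u → 0 < p → u ≠ p → √(x ^ 2 + u) ≠ √(x ^ 2 + p) := by
    intro u p hu hp hup h
    rw [Real.sqrt_inj (by positivity) (by positivity)] at h
    exact hup (add_left_cancel h)
  have hi := fun hm : -1 < m => integrableOn_V_integrand hm hx
  refine ⟨fun hm => ?_, fun hm => ?_⟩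
  · have hG := Real.Gamma_pos_of_pos hm
    have hb : 0 < √(x ^ 2 + m) := by positivity
    have heq : EqOn (fun u => u ^ m * exp (-u) / √(x ^ 2 + u))
        (fun u => u ^ (m - 1) * exp (-u) * (u / √(x ^ 2 + u))) (Ioi 0) := by
      intro u hu
      have hpow : u ^ m = u ^ (m - 1) * u := by
        rw [← rpow_add_one (ne_of_gt hu), sub_add_cancel]
      simp only [hpow]
      ring
    have := integral_gamma_weight_lt_of_lt_affine hm
      ((hi (by linarith)).congr_fun heq measurableSet_Ioi) (A := m / √(x ^ 2 + m))
      (B := 1 / (2 * √(x ^ 2 + m)) + x ^ 2 / (2 * √(x ^ 2 + m) ^ 3)) (by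
        intro u hu hup
        have := sub_div_lt_tangent (a := √(x ^ 2 + u)) (y := x ^ 2) (by positivity) hb
          (sqrt_ne hu hm hup) (by positivity)
        rw [Real.sq_sqrt (by positivity), Real.sq_sqrt (by positivity)] at this
        simpa using this)
    rw [← setIntegral_congr_fun measurableSet_Ioi heq] at this
    rw [V, Real.Gamma_add_one hm.ne', one_div_mul_eq_div, div_lt_iff₀ (by positivity)]
    exact this.trans_eq (by ring)
  · have hm' : 0 < m + 1 := by linarith
    have hG := Real.Gamma_pos_of_pos hm'
    have hb : 0 < √(x ^ 2 + (m + 1)) := by positivity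
    have heq : (fun u => -(u ^ m * exp (-u) / √(x ^ 2 + u))) =
        fun u => u ^ (m + 1 - 1) * exp (-u) * (-(1 / √(x ^ 2 + u))) := by
      funext u
      rw [add_sub_cancel_right]
      ring
    have hk : IntegrableOn (fun u => -(u ^ m * exp (-u) / √(x ^ 2 + u))) (Ioi 0) := (hi hm).neg
    rw [heq] at hk
    have := integral_gamma_weight_lt_of_lt_affine hm' hk
      (A := -(1 / √(x ^ 2 + (m + 1)))) (B := 1 / (2 * √(x ^ 2 + (m + 1)) ^ 3)) (by
        intro u hu hup
        have := one_div_gt_tangent (a := √(x ^ 2 + u)) (by positivity) hb (sqrt_ne hu hm' hup)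
        rw [Real.sq_sqrt (by positivity), Real.sq_sqrt (by positivity),
          add_sub_add_left_eq_sub] at this
        linarith)
    rw [← heq, integral_neg] at this
    rw [V, add_assoc, one_div_mul_eq_div, lt_div_iff₀ hG]
    linarith
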